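/- arXiv:1003.5151 — 3 statements merged into one kernel-verified Lean document; each statement's English description precedes it below -/
import Mathlib

section
/- Let k be a field of characteristic p > 0 and let n ≥ 1 be an integer. Then the Weyl algebra A_n(k), realized as the k-subalgebra of the k-linear endomorphism ring End_k(k[x_1,…,x_n]) generated by the multiplication operators by x_1,…,x_n together with all divided power operators ∂_i^[r] for 1 ≤ i ≤ n and r ≥ 1, is a coherent ring (both left and right coherent). -/
/-- The divided power operator `∂_i^[r]` on `k[x_1,…,x_n]`, the `k`-linear map determined on
monomials by `∂_i^[r](x^m) = C(m_i, r) • x^(m - r·ε_i)` (zero when `m_i < r`). -/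
noncomputable def dividedPower (k : Type*) [Field k] (n : ℕ) (i : Fin n) (r : ℕ) :
    Module.End k (MvPolynomial (Fin n) k) :=
  (MvPolynomial.basisMonomials (Fin n) k).constr k fun m =>
    ((m i).choose r : k) • MvPolynomial.monomial (m - Finsupp.single i r) 1

/-- The Weyl algebra `A_n(k)`, the `k`-subalgebra of `End_k(k[x_1,…,x_n])` generated by the
multiplication operators by `x_1,…,x_n` together with all divided powers `∂_i^[r]`, `r ≥ 1`. -/
noncomputable def weylAlgebra (k : Type*) [Field k] (n : ℕ) :
    Subalgebra k (Module.End k (MvPolynomial (Fin n) k)) :=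
  Algebra.adjoin k
    ((Set.range fun i : Fin n => (LinearMap.mulLeft k (MvPolynomial.X i) :
        Module.End k (MvPolynomial (Fin n) k))) ∪
      {f | ∃ (i : Fin n) (r : ℕ), 1 ≤ r ∧ f = dividedPower k n i r})

/-- A ring is left coherent if every finitely generated left ideal is finitely presented. -/
def IsLeftCoherent (R : Type*) [Ring R] : Prop :=
  ∀ I : Ideal R, I.FG → Module.FinitePresentation R I

/-- A ring is right coherent if every finitely generated right ideal is finitely presented. -/
def IsRightCoherent (R : Type*) [Ring R] : Prop :=
  ∀ I : Ideal Rᵐᵒᵖ, I.FG → Module.FinitePresentation Rᵐᵒᵖ I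

/-- The subalgebra `A_r = k[x_1^{p^r},…,x_n^{p^r}]` of `A = k[x_1,…,x_n]`. -/
noncomputable def subAr (k : Type*) [Field k] (n p r : ℕ) :
    Subalgebra k (MvPolynomial (Fin n) k) :=
  Algebra.adjoin k (Set.range fun i : Fin n => MvPolynomial.X i ^ p ^ r)

/-- The ring `D_r = End_{A_r}(A)` of `A_r`-module endomorphisms of `A`, viewed as the subring of
`End_k(A)` of endomorphisms commuting with multiplication by elements of `A_r`. -/
noncomputable def endAr (k : Type*) [Field k] (n p r : ℕ) :
    Subring (Module.End k (MvPolynomial (Fin n) k)) :=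
  Subring.centralizer
    ((fun b => (LinearMap.mulLeft k b : Module.End k (MvPolynomial (Fin n) k))) ''
      (subAr k n p r : Set (MvPolynomial (Fin n) k)))

universe u

/-- Every finite tuple of `S` lies in the image of a left Noetherian ring `D`, over which any
finite tuple of `S` is expanded by finitely many elements of `S` with right `D`-linear coordinate
functionals. -/
def HasNoetherianDualBases (S : Type u) [Ring S] : Prop :=
  ∀ (m : ℕ) (a : Fin m → S), ∃ (D : Type u) (_ : Ring D) (_ : IsNoetherianRing D) (j : D →+* S),
    (∀ l, ∃ d, j d = a l) ∧ ∀ c : Fin m → S, ∃ (ι : Type) (_ : Fintype ι) (e : ι → S)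
      (φ : ι → S →+ D), (∀ i x d, φ i (x * j d) = φ i x * d) ∧
        ∀ l, c l = ∑ i, e i * j (φ i (c l))

theorem HasNoetherianDualBases.of_ringEquiv {S T : Type u} [Ring S] [Ring T] (f : S ≃+* T)
    (h : HasNoetherianDualBases S) : HasNoetherianDualBases T := by
  intro m a
  obtain ⟨D, _, hD, j, ha, hc⟩ := h m fun l => f.symm (a l)
  refine ⟨D, _, hD, f.toRingHom.comp j, fun l => ?_, fun c => ?_⟩
  · obtain ⟨d, hd⟩ := ha l
    exact ⟨d, by simp [hd]⟩
  · obtain ⟨ι, _, e, φ, hφ, hc⟩ := hc fun l => f.symm (c l)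
    refine ⟨ι, ‹_›, fun i => f (e i), fun i => (φ i).comp f.symm.toAddMonoidHom,
      fun i x d => ?_, fun l => ?_⟩
    · simpa using hφ i (f.symm x) d
    · have := congrArg f (hc l)
      simpa using this

theorem HasNoetherianDualBases.fg_ker {S : Type u} [Ring S] (h : HasNoetherianDualBases S)
    {m : ℕ} (a : Fin m → S) : (LinearMap.ker (Fintype.linearCombination S a)).FG := by
  classical
  obtain ⟨D, _, hD, j, ha, hc⟩ := h m a
  choose a' ha' using ha
  obtain ⟨T, hT⟩ := IsNoetherian.noetherian (LinearMap.ker (Fintype.linearCombination D a'))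
  have hker : ∀ b : Fin m → D, b ∈ LinearMap.ker (Fintype.linearCombination D a') →
      (fun l => j (b l)) ∈ LinearMap.ker (Fintype.linearCombination S a) := by
    intro b hb
    have := congrArg j (LinearMap.mem_ker.1 hb)
    simpa [Fintype.linearCombination_apply, ha'] using this
  have hspan : ∀ b : Fin m → D, b ∈ Submodule.span D (T : Set (Fin m → D)) →
      (fun l => j (b l)) ∈ Submodule.span S
        ((T.image fun b l => j (b l) : Finset (Fin m → S)) : Set (Fin m → S)) := by
    intro b hb
    induction hb using Submodule.span_induction with
    | mem x hx => exact Submodule.subset_span (Finset.mem_coe.2 (Finset.mem_image_of_mem _ hx))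
    | zero => simp [← Pi.zero_def]
    | add x y _ _ hx hy => simpa [← Pi.add_def] using Submodule.add_mem _ hx hy
    | smul d x _ hx =>
      have := Submodule.smul_mem _ (j d) hx
      simpa [Pi.smul_def] using this
  refine ⟨T.image fun b l => j (b l), le_antisymm (Submodule.span_le.2 ?_) fun c hcker => ?_⟩
  · intro x hx
    obtain ⟨b, hb, rfl⟩ := Finset.mem_image.1 (Finset.mem_coe.1 hx)
    exact hker b (hT ▸ Submodule.subset_span hb)
  · obtain ⟨ι, _, e, φ, hφ, hc⟩ := hc c
    have hsum : c = ∑ i, e i • fun l => j (φ i (c l)) := by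
      ext l
      simpa using hc l
    rw [hsum]
    refine Submodule.sum_mem _ fun i _ => Submodule.smul_mem _ _
      (hspan (fun l => φ i (c l)) ?_)
    rw [hT, LinearMap.mem_ker, Fintype.linearCombination_apply]
    have hcker' : ∑ l, c l * j (a' l) = 0 := by
      simpa [Fintype.linearCombination_apply, ha'] using hcker
    simpa [hφ] using congrArg (φ i) hcker'

theorem HasNoetherianDualBases.finitePresentation {S : Type u} [Ring S]
    (h : HasNoetherianDualBases S) (I : Ideal S) (hI : I.FG) : Module.FinitePresentation S I := by
  obtain ⟨m, a, rfl⟩ := Submodule.fg_iff_exists_fin_generating_family.1 hI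
  rw [← Fintype.range_linearCombination]
  refine Module.finitePresentation_of_surjective
    (Fintype.linearCombination S a).rangeRestrict (LinearMap.surjective_rangeRestrict _) ?_
  rw [LinearMap.ker_rangeRestrict]
  exact h.fg_ker a

theorem isNoetherianRing_mulOpposite_end (B M : Type*) [CommRing B] [IsNoetherianRing B]
    [AddCommGroup M] [Module B M] [Module.Finite B M] :
    IsNoetherianRing (Module.End B M)ᵐᵒᵖ :=
  isNoetherian_of_tower B (isNoetherian_of_linearEquiv
    (MulOpposite.opLinearEquiv B : Module.End B M ≃ₗ[B] (Module.End B M)ᵐᵒᵖ))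

open MvPolynomial

/-- The monomial `x^a` with exponents `a_l < q`. -/
noncomputable def boxMonomial (k : Type*) [Field k] {n q : ℕ} (a : Fin n → Fin q) :
    MvPolynomial (Fin n) k :=
  monomial (Finsupp.equivFunOnFinite.symm fun l => (a l : ℕ)) 1

/-- The operator sending `x^m` to `x^(m - (q-1)(1,…,1))` if every `m_i` is congruent to `q - 1`
modulo `q`, and to `0` otherwise. -/
noncomputable def topCoeff (k : Type*) [Field k] (n q : ℕ) :
    Module.End k (MvPolynomial (Fin n) k) :=
  (basisMonomials (Fin n) k).constr k fun m =>
    if ∀ i, m i % q = q - 1 then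
      monomial (m - Finsupp.equivFunOnFinite.symm fun _ => q - 1) 1 else 0

/-- The operators on `k[x_1,…,x_n]` linear over `k[x_1^q,…,x_n^q]`. -/
def IsExpandLinear {k : Type*} [Field k] {n : ℕ} (q : ℕ)
    (c : Module.End k (MvPolynomial (Fin n) k)) : Prop :=
  ∀ g f, c (expand q g * f) = expand q g * c f

section Field

variable {k : Type*} [Field k] {n : ℕ}

theorem dividedPower_monomial (i : Fin n) (r : ℕ) (m : Fin n →₀ ℕ) :
    dividedPower k n i r (monomial m 1) =
      ((m i).choose r : k) • monomial (m - Finsupp.single i r) 1 := by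
  exact (basisMonomials (Fin n) k).constr_basis k _ m

theorem topCoeff_monomial (q : ℕ) (m : Fin n →₀ ℕ) :
    topCoeff k n q (monomial m 1) = if ∀ i, m i % q = q - 1 then
      monomial (m - Finsupp.equivFunOnFinite.symm fun _ => q - 1) 1 else 0 := by
  exact (basisMonomials (Fin n) k).constr_basis k _ m

theorem linearMap_ext_monomial {M : Type*} [AddCommGroup M] [Module k M]
    {c d : MvPolynomial (Fin n) k →ₗ[k] M} (h : ∀ m, c (monomial m 1) = d (monomial m 1))
    (f : MvPolynomial (Fin n) k) : c f = d f :=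
  LinearMap.congr_fun ((basisMonomials (Fin n) k).ext fun m => by simpa using h m) f

theorem isExpandLinear_of_monomial {q : ℕ} {c : Module.End k (MvPolynomial (Fin n) k)}
    (h : ∀ a b, c (monomial (q • a + b) 1) = monomial (q • a) 1 * c (monomial b 1)) :
    IsExpandLinear q c := by
  intro g f
  refine linearMap_ext_monomial (c := c ∘ₗ LinearMap.mulLeft k (expand q g))
    (d := LinearMap.mulLeft k (expand q g) ∘ₗ c) (fun b => ?_) f
  refine linearMap_ext_monomial
    (c := c ∘ₗ LinearMap.mulRight k (monomial b 1) ∘ₗ (expand q).toLinearMap)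
    (d := LinearMap.mulRight k (c (monomial b 1)) ∘ₗ (expand q).toLinearMap) (fun a => ?_) g
  simpa [expand_monomial, monomial_mul] using h a b

theorem isExpandLinear_mulLeft (q : ℕ) (a : MvPolynomial (Fin n) k) :
    IsExpandLinear q (LinearMap.mulLeft k a) := fun g f => by
  simp only [LinearMap.mulLeft_apply]
  ring

theorem IsExpandLinear.add {q : ℕ} {c d : Module.End k (MvPolynomial (Fin n) k)}
    (hc : IsExpandLinear q c) (hd : IsExpandLinear q d) : IsExpandLinear q (c + d) :=
  fun g f => by simp [hc g f, hd g f, mul_add]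

theorem IsExpandLinear.mul {q : ℕ} {c d : Module.End k (MvPolynomial (Fin n) k)}
    (hc : IsExpandLinear q c) (hd : IsExpandLinear q d) : IsExpandLinear q (c * d) :=
  fun g f => by simp [hc g, hd g f]

theorem IsExpandLinear.of_dvd {q s : ℕ} {c : Module.End k (MvPolynomial (Fin n) k)}
    (hc : IsExpandLinear q c) (h : q ∣ s) : IsExpandLinear s c := by
  obtain ⟨t, rfl⟩ := h
  intro g f
  rw [expand_mul, hc]

theorem isExpandLinear_topCoeff (q : ℕ) : IsExpandLinear q (topCoeff k n q) := by
  refine isExpandLinear_of_monomial fun a b => ?_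
  simp only [topCoeff_monomial, Finsupp.add_apply, Finsupp.smul_apply, smul_eq_mul,
    Nat.mul_add_mod]
  split_ifs with h
  · rw [monomial_mul, one_mul]
    refine congrArg (fun e => monomial e (1 : k)) (Finsupp.ext fun i => ?_)
    have := h i
    have := Nat.mod_le (b i) q
    simp
    lia
  · simp

theorem sum_boxMonomial_mul_topCoeff {q : ℕ} (hq : 0 < q) (f : MvPolynomial (Fin n) k) :
    ∑ a : Fin n → Fin q, boxMonomial k a * topCoeff k n q (boxMonomial k (Fin.rev ∘ a) * f)
      = f := by
  have key := linearMap_ext_monomial (k := k) (n := n) (d := LinearMap.id)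
    (c := ∑ a : Fin n → Fin q, LinearMap.mulLeft k (boxMonomial k a) ∘ₗ topCoeff k n q ∘ₗ
      LinearMap.mulLeft k (boxMonomial k (Fin.rev ∘ a))) (fun m => ?_) f
  · simpa using key
  simp only [LinearMap.sum_apply, LinearMap.comp_apply, LinearMap.mulLeft_apply,
    LinearMap.id_apply]
  rw [Finset.sum_eq_single fun l => ⟨m l % q, Nat.mod_lt _ hq⟩]
  · rw [boxMonomial, boxMonomial, monomial_mul, one_mul, topCoeff_monomial, if_pos,
      monomial_mul, one_mul]
    · refine congrArg (fun e => monomial e (1 : k)) (Finsupp.ext fun l => ?_)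
      have := Nat.mod_lt (m l) hq
      have := Nat.mod_le (m l) q
      simp [Fin.val_rev]
      lia
    · intro l
      have h1 := Nat.mod_lt (m l) hq
      have h2 := Nat.div_add_mod (m l) q
      have h3 : (q - (m l % q + 1)) + m l = q * (m l / q) + (q - 1) := by lia
      simp only [Finsupp.add_apply, Finsupp.equivFunOnFinite_symm_apply_apply,
        Function.comp_apply, Fin.val_rev]
      rw [h3, Nat.mul_add_mod, Nat.mod_eq_of_lt (by lia)]
  · intro a _ ha
    rw [boxMonomial, boxMonomial, monomial_mul, one_mul, topCoeff_monomial, if_neg, mul_zero]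
    intro h
    refine ha (funext fun l => Fin.ext ?_)
    have h0 := h l
    simp only [Finsupp.add_apply, Finsupp.equivFunOnFinite_symm_apply_apply,
      Function.comp_apply, Fin.val_rev] at h0
    have h1 := Nat.div_add_mod ((q - (a l + 1)) + m l) q
    rw [h0] at h1
    have h4 := (a l).isLt
    have h3 : m l = q * ((q - (a l + 1) + m l) / q) + a l := by lia
    change (a l : ℕ) = m l % q
    rw [h3, Nat.mul_add_mod, Nat.mod_eq_of_lt h4]
  · simp

theorem exists_expand_eq_topCoeff (q : ℕ) (f : MvPolynomial (Fin n) k) :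
    ∃ g, expand q g = topCoeff k n q f := by
  suffices h : ⊤ ≤ ((expand q : MvPolynomial (Fin n) k →ₐ[k] _).toLinearMap.range).comap
      (topCoeff k n q) from h (Submodule.mem_top (x := f))
  rw [← (basisMonomials (Fin n) k).span_eq, Submodule.span_le]
  rintro _ ⟨m, rfl⟩
  simp only [coe_basisMonomials, Submodule.comap_coe, Set.mem_preimage, SetLike.mem_coe,
    topCoeff_monomial]
  split_ifs with h
  · refine ⟨monomial (Finsupp.equivFunOnFinite.symm fun l => m l / q) 1, ?_⟩
    simp only [AlgHom.toLinearMap_apply, expand_monomial]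
    refine congrArg (fun e => monomial e (1 : k)) (Finsupp.ext fun l => ?_)
    have := h l
    have := Nat.div_add_mod (m l) q
    simp
    lia
  · exact Submodule.zero_mem _

theorem topCoeff_monomial_mul_topCoeff {q t : ℕ} (hq : 0 < q) (ht : 0 < t)
    (f : MvPolynomial (Fin n) k) :
    topCoeff k n (q * t) ((monomial (Finsupp.equivFunOnFinite.symm fun _ => q - 1) 1) *
      topCoeff k n q f) = topCoeff k n (q * t) f := by
  refine linearMap_ext_monomial (k := k) (n := n) (d := topCoeff k n (q * t))
    (c := topCoeff k n (q * t) ∘ₗ LinearMap.mulLeft k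
      (monomial (Finsupp.equivFunOnFinite.symm fun _ => q - 1) 1) ∘ₗ topCoeff k n q)
      (fun m => ?_) f
  simp only [LinearMap.comp_apply, LinearMap.mulLeft_apply]
  rw [topCoeff_monomial q]
  split_ifs with h
  · rw [monomial_mul, one_mul]
    refine congrArg (fun e => topCoeff k n (q * t) (monomial e (1 : k)))
      (Finsupp.ext fun l => ?_)
    have := h l
    have := Nat.mod_le (m l) q
    simp
    lia
  · rw [mul_zero, map_zero, topCoeff_monomial, if_neg]
    contrapose! h
    intro l
    have h1 := h l
    have h2 : m l % (q * t) % q = m l % q := Nat.mod_mul_right_mod _ _ _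
    obtain ⟨t, rfl⟩ := Nat.exists_eq_succ_of_ne_zero ht.ne'
    rw [← h2, h1, show q * t.succ - 1 = q * t + (q - 1) by rw [Nat.mul_succ]; lia,
      Nat.mul_add_mod, Nat.mod_eq_of_lt (by lia)]

/-- `d` is adjoint to `c` for the bilinear form `(f, g) ↦ topCoeff k n q (f * g)`. -/
def IsTopAdjoint (q : ℕ) (c d : Module.End k (MvPolynomial (Fin n) k)) : Prop :=
  ∀ f g, topCoeff k n q (c f * g) = topCoeff k n q (f * d g)

theorem IsTopAdjoint.symm {q : ℕ} {c d : Module.End k (MvPolynomial (Fin n) k)}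
    (h : IsTopAdjoint q c d) : IsTopAdjoint q d c := fun f g => by
  rw [mul_comm, ← h, mul_comm]

theorem IsTopAdjoint.add {q : ℕ} {c c' d d' : Module.End k (MvPolynomial (Fin n) k)}
    (h : IsTopAdjoint q c d) (h' : IsTopAdjoint q c' d') : IsTopAdjoint q (c + c') (d + d') :=
  fun f g => by simp [add_mul, mul_add, h f g, h' f g]

theorem IsTopAdjoint.mul {q : ℕ} {c c' d d' : Module.End k (MvPolynomial (Fin n) k)}
    (h : IsTopAdjoint q c d) (h' : IsTopAdjoint q c' d') : IsTopAdjoint q (c * c') (d' * d) :=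
  fun f g => by simp [h _ g, h' f]

theorem IsTopAdjoint.eq {q : ℕ} (hq : 0 < q) {c d d' : Module.End k (MvPolynomial (Fin n) k)}
    (h : IsTopAdjoint q c d) (h' : IsTopAdjoint q c d') : d = d' := by
  refine LinearMap.ext fun f => ?_
  rw [← sum_boxMonomial_mul_topCoeff hq (d f), ← sum_boxMonomial_mul_topCoeff hq (d' f)]
  simp only [← h _ _, ← h' _ _]

theorem IsTopAdjoint.of_dvd {q s : ℕ} (hs : 0 < s) (hqs : q ∣ s)
    {c d : Module.End k (MvPolynomial (Fin n) k)} (h : IsTopAdjoint q c d) :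
    IsTopAdjoint s c d := by
  obtain ⟨t, rfl⟩ := hqs
  have hq := Nat.pos_of_mul_pos_right hs
  have ht := Nat.pos_of_mul_pos_left hs
  intro f g
  rw [← topCoeff_monomial_mul_topCoeff hq ht, h, topCoeff_monomial_mul_topCoeff hq ht]

theorem IsExpandLinear.apply_eq_sum {q : ℕ} (hq : 0 < q)
    {c : Module.End k (MvPolynomial (Fin n) k)} (hc : IsExpandLinear q c)
    (f : MvPolynomial (Fin n) k) :
    c f = ∑ a : Fin n → Fin q, c (boxMonomial k a) *
      topCoeff k n q (boxMonomial k (Fin.rev ∘ a) * f) := by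
  conv_lhs => rw [← sum_boxMonomial_mul_topCoeff hq f, map_sum]
  refine Finset.sum_congr rfl fun a _ => ?_
  obtain ⟨g, hg⟩ := exists_expand_eq_topCoeff q (boxMonomial k (Fin.rev ∘ a) * f)
  rw [← hg, mul_comm, hc, mul_comm]

theorem IsExpandLinear.exists_isTopAdjoint {q : ℕ} (hq : 0 < q)
    {c : Module.End k (MvPolynomial (Fin n) k)} (hc : IsExpandLinear q c) :
    ∃ d, IsExpandLinear q d ∧ IsTopAdjoint q c d := by
  refine ⟨∑ a : Fin n → Fin q, LinearMap.mulLeft k (boxMonomial k (Fin.rev ∘ a)) ∘ₗ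
    topCoeff k n q ∘ₗ LinearMap.mulLeft k (c (boxMonomial k a)), fun g f => ?_, fun f g => ?_⟩
  · simp only [LinearMap.sum_apply, LinearMap.comp_apply, LinearMap.mulLeft_apply,
      Finset.mul_sum]
    refine Finset.sum_congr rfl fun a _ => ?_
    rw [mul_left_comm (c _), isExpandLinear_topCoeff]
    ring
  · simp only [LinearMap.sum_apply, LinearMap.comp_apply, LinearMap.mulLeft_apply,
      Finset.mul_sum, map_sum, hc.apply_eq_sum hq f, Finset.sum_mul]
    refine Finset.sum_congr rfl fun a _ => ?_
    obtain ⟨u, hu⟩ := exists_expand_eq_topCoeff q (boxMonomial k (Fin.rev ∘ a) * f)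
    obtain ⟨v, hv⟩ := exists_expand_eq_topCoeff q (c (boxMonomial k a) * g)
    rw [← hu, mul_comm _ (expand q u), mul_assoc, isExpandLinear_topCoeff, hu, ← hv,
      ← mul_assoc, mul_comm (f * _) (expand q v), isExpandLinear_topCoeff, mul_comm f, mul_comm]

end Field

theorem mulLeft_mem_weylAlgebra {k : Type*} [Field k] {n : ℕ} (f : MvPolynomial (Fin n) k) :
    LinearMap.mulLeft k f ∈ weylAlgebra k n := by
  induction f using MvPolynomial.induction_on with
  | C a =>
    convert (weylAlgebra k n).algebraMap_mem a using 1
    refine LinearMap.ext fun g => ?_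
    simp [Module.algebraMap_end_apply, MvPolynomial.C_mul']
  | add f g hf hg =>
    convert (weylAlgebra k n).add_mem hf hg using 1
    refine LinearMap.ext fun h => ?_
    simp [add_mul]
  | mul_X f i hf =>
    convert (weylAlgebra k n).mul_mem hf (Algebra.subset_adjoin (Or.inl ⟨i, rfl⟩)) using 1
    refine LinearMap.ext fun h => ?_
    simp

theorem dividedPower_mem_weylAlgebra {k : Type*} [Field k] {n : ℕ} (i : Fin n) (r : ℕ) :
    dividedPower k n i r ∈ weylAlgebra k n := by
  rcases Nat.eq_zero_or_pos r with rfl | hr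
  · convert (weylAlgebra k n).one_mem
    refine LinearMap.ext fun f => linearMap_ext_monomial (fun m => ?_) f
    simp [dividedPower_monomial]
  · exact Algebra.subset_adjoin (Or.inr ⟨i, r, hr, rfl⟩)

section CharP

variable {k : Type*} [Field k] {n p : ℕ} [Fact p.Prime] [CharP k p]

theorem cast_choose_pow_mul_add {r m : ℕ} (hm : m < p ^ r) (a b : ℕ) :
    ((p ^ r * a + b).choose m : k) = (b.choose m : k) := by
  induction a with
  | zero => simp
  | succ a ih =>
    rw [← ih, show p ^ r * (a + 1) + b = p ^ r + (p ^ r * a + b) by ring, Nat.add_choose_eq,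
      Nat.cast_sum, Finset.sum_eq_single (0, m)]
    · simp
    · rintro ⟨i, j⟩ hij hne
      have hij' := Finset.HasAntidiagonal.mem_antidiagonal.1 hij
      have hi : i ≠ 0 := by
        rintro rfl
        simp_all
      have hd := (Fact.out : p.Prime).dvd_choose_pow (n := r) hi (by simp at hij'; lia)
      rw [Nat.cast_mul, (CharP.cast_eq_zero_iff k p _).2 hd, zero_mul]
    · simp

theorem cast_choose_pow_sub_one (r a : ℕ) :
    (a.choose (p ^ r - 1) : k) = if a % p ^ r = p ^ r - 1 then 1 else 0 := by
  have hq : 0 < p ^ r := pow_pos (Fact.out : p.Prime).pos r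
  rw [← Nat.div_add_mod a (p ^ r), cast_choose_pow_mul_add (by lia), Nat.mul_add_mod,
    Nat.mod_mod]
  split_ifs with h
  · simp [h]
  · have := Nat.mod_lt a hq
    rw [Nat.choose_eq_zero_of_lt (by lia), Nat.cast_zero]

theorem isExpandLinear_dividedPower (i : Fin n) {m r : ℕ} (hm : m < p ^ r) :
    IsExpandLinear (p ^ r) (dividedPower k n i m) := by
  refine isExpandLinear_of_monomial fun a b => ?_
  simp only [dividedPower_monomial, Finsupp.add_apply, Finsupp.smul_apply, smul_eq_mul,
    cast_choose_pow_mul_add (k := k) hm, mul_smul_comm, monomial_mul, one_mul]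
  rcases lt_or_ge (b i) m with h | h
  · simp [Nat.choose_eq_zero_of_lt h]
  · rw [add_tsub_assoc_of_le (by simpa using h)]

theorem exists_isExpandLinear_of_mem_weylAlgebra {c : Module.End k (MvPolynomial (Fin n) k)}
    (hc : c ∈ weylAlgebra k n) : ∃ r, ∀ s, r ≤ s → IsExpandLinear (p ^ s) c := by
  rw [weylAlgebra] at hc
  induction hc using Algebra.adjoin_induction with
  | mem x hx =>
    rcases hx with ⟨i, rfl⟩ | ⟨i, m, -, rfl⟩
    · exact ⟨0, fun s _ => isExpandLinear_mulLeft _ _⟩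
    · exact ⟨m, fun s hs => isExpandLinear_dividedPower i
        (hs.trans_lt (Nat.lt_pow_self (Fact.out : p.Prime).one_lt))⟩
  | algebraMap a =>
    refine ⟨0, fun s _ g f => ?_⟩
    simp [Module.algebraMap_end_apply]
  | add x y _ _ hx hy =>
    obtain ⟨r, hr⟩ := hx
    obtain ⟨r', hr'⟩ := hy
    exact ⟨max r r', fun s hs => (hr s (le_of_max_le_left hs)).add (hr' s (le_of_max_le_right hs))⟩
  | mul x y _ _ hx hy =>
    obtain ⟨r, hr⟩ := hx
    obtain ⟨r', hr'⟩ := hy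
    exact ⟨max r r', fun s hs => (hr s (le_of_max_le_left hs)).mul (hr' s (le_of_max_le_right hs))⟩

theorem exists_forall_isExpandLinear {m : ℕ} (c : Fin m → weylAlgebra k n) (r₀ : ℕ) :
    ∃ r, r₀ ≤ r ∧ ∀ l, IsExpandLinear (p ^ r) (c l).1 := by
  choose r hr using fun l => exists_isExpandLinear_of_mem_weylAlgebra (p := p) (c l).2
  exact ⟨max r₀ (Finset.univ.sup r), le_max_left _ _, fun l =>
    hr l _ ((Finset.le_sup (Finset.mem_univ l)).trans (le_max_right _ _))⟩

theorem topCoeff_mem_weylAlgebra (r : ℕ) : topCoeff k n (p ^ r) ∈ weylAlgebra k n := by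
  suffices h : ∀ S : Finset (Fin n), ∃ c ∈ weylAlgebra k n, ∀ m, c (monomial m 1) =
      if ∀ i ∈ S, m i % p ^ r = p ^ r - 1 then
        monomial (m - Finsupp.equivFunOnFinite.symm fun i => if i ∈ S then p ^ r - 1 else 0)
          (1 : k) else 0 by
    obtain ⟨c, hc, h⟩ := h Finset.univ
    convert hc
    refine LinearMap.ext fun f => linearMap_ext_monomial (fun m => ?_) f
    rw [h, topCoeff_monomial]
    simp
  intro S
  induction S using Finset.induction_on with
  | empty =>
    refine ⟨1, one_mem _, fun m => ?_⟩
    rw [if_pos (by simp)]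
    refine congrArg (fun e => monomial e (1 : k)) (Finsupp.ext fun l => ?_)
    simp
  | insert i S hi ih =>
    obtain ⟨c, hc, h⟩ := ih
    refine ⟨dividedPower k n i (p ^ r - 1) * c, mul_mem (dividedPower_mem_weylAlgebra _ _) hc,
      fun m => ?_⟩
    rw [Module.End.mul_apply, h]
    simp only [Finset.forall_mem_insert]
    by_cases hS : ∀ j ∈ S, m j % p ^ r = p ^ r - 1
    · rw [if_pos hS, dividedPower_monomial, cast_choose_pow_sub_one]
      simp only [Finsupp.tsub_apply, Finsupp.equivFunOnFinite_symm_apply_apply, hi, if_false,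
        tsub_zero]
      by_cases hm : m i % p ^ r = p ^ r - 1
      · rw [if_pos hm, if_pos ⟨hm, hS⟩, one_smul]
        refine congrArg (fun e => monomial e (1 : k)) (Finsupp.ext fun l => ?_)
        rcases eq_or_ne l i with rfl | hl
        · simp [hi]
        · simp [hl]
      · rw [if_neg hm, if_neg fun h => hm h.1, zero_smul]
    · rw [if_neg hS, if_neg fun h => hS h.2, map_zero]

theorem IsExpandLinear.mem_weylAlgebra {r : ℕ} {c : Module.End k (MvPolynomial (Fin n) k)}
    (hc : IsExpandLinear (p ^ r) c) : c ∈ weylAlgebra k n := by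
  have hq : 0 < p ^ r := pow_pos (Fact.out : p.Prime).pos r
  have : c = ∑ a : Fin n → Fin (p ^ r), LinearMap.mulLeft k (c (boxMonomial k a)) *
      (topCoeff k n (p ^ r) * LinearMap.mulLeft k (boxMonomial k (Fin.rev ∘ a))) := by
    refine LinearMap.ext fun f => ?_
    rw [hc.apply_eq_sum hq]
    simp
  rw [this]
  exact sum_mem fun a _ => mul_mem (mulLeft_mem_weylAlgebra _)
    (mul_mem (topCoeff_mem_weylAlgebra r) (mulLeft_mem_weylAlgebra _))

theorem finite_range_expand {q : ℕ} (hq : 0 < q) :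
    Module.Finite (expand q : MvPolynomial (Fin n) k →ₐ[k] _).range (MvPolynomial (Fin n) k) := by
  refine ⟨Submodule.fg_def.2 ⟨Set.range fun a : Fin n → Fin q => boxMonomial k a,
    Set.finite_range _, eq_top_iff.2 fun f _ => ?_⟩⟩
  rw [← sum_boxMonomial_mul_topCoeff hq f]
  refine Submodule.sum_mem _ fun a _ => ?_
  obtain ⟨g, hg⟩ := exists_expand_eq_topCoeff q (boxMonomial k (Fin.rev ∘ a) * f)
  rw [← hg, mul_comm]
  exact Submodule.smul_mem _ (⟨expand q g, g, rfl⟩ : (expand q : _ →ₐ[k] _).range)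
    (Submodule.subset_span ⟨a, rfl⟩)

theorem isNoetherianRing_mulOpposite_end_range_expand {q : ℕ} (hq : 0 < q) :
    IsNoetherianRing (Module.End (expand q : MvPolynomial (Fin n) k →ₐ[k] _).range
      (MvPolynomial (Fin n) k))ᵐᵒᵖ := by
  have := finite_range_expand (k := k) (n := n) hq
  have : IsNoetherianRing (expand q : MvPolynomial (Fin n) k →ₐ[k] _).range :=
    isNoetherianRing_of_surjective _ _
      (expand q : MvPolynomial (Fin n) k →ₐ[k] _).rangeRestrict.toRingHom
      (AlgHom.rangeRestrict_surjective _)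
  exact isNoetherianRing_mulOpposite_end _ _

theorem topCoeff_monomial_mul_topCoeff_of_dvd {q s : ℕ} (hq : 0 < q) (hqs : q ∣ s)
    (f : MvPolynomial (Fin n) k) :
    topCoeff k n q (monomial (Finsupp.equivFunOnFinite.symm fun _ => q - 1) 1 *
      topCoeff k n s f) = topCoeff k n s f := by
  obtain ⟨t, rfl⟩ := hqs
  obtain ⟨g, hg⟩ := exists_expand_eq_topCoeff (q * t) f
  rw [← hg, expand_mul, mul_comm (monomial _ _), isExpandLinear_topCoeff,
    topCoeff_monomial, if_pos]
  · simp
  · intro i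
    simp [Nat.mod_eq_of_lt, hq]

/-- An operator linear over `k[x_1^q,…,x_n^q]`, as a linear map over that subalgebra. -/
noncomputable def IsExpandLinear.toEnd {q : ℕ} {c : Module.End k (MvPolynomial (Fin n) k)}
    (hc : IsExpandLinear q c) : Module.End (expand q : MvPolynomial (Fin n) k →ₐ[k] _).range
      (MvPolynomial (Fin n) k) where
  toFun := c
  map_add' := c.map_add
  map_smul' := by
    rintro ⟨_, g, rfl⟩ f
    exact hc g f

theorem IsExpandLinear.toEnd_apply {q : ℕ} {c : Module.End k (MvPolynomial (Fin n) k)}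
    (hc : IsExpandLinear q c) (f : MvPolynomial (Fin n) k) : hc.toEnd f = c f :=
  rfl

theorem isExpandLinear_restrictScalars {q : ℕ}
    (d : Module.End (expand q : MvPolynomial (Fin n) k →ₐ[k] _).range
      (MvPolynomial (Fin n) k)) : IsExpandLinear q (d.restrictScalars k) := fun g f =>
  d.map_smul (⟨expand q g, g, rfl⟩ : (expand q : _ →ₐ[k] _).range) f

variable (k n p) in
/-- The inclusion into the Weyl algebra of the operators linear over
`k[x_1^(p^r),…,x_n^(p^r)]`. -/
noncomputable def endToWeylAlgebra (r : ℕ) :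
    Module.End (expand (p ^ r) : MvPolynomial (Fin n) k →ₐ[k] _).range
      (MvPolynomial (Fin n) k) →+* weylAlgebra k n where
  toFun d := ⟨d.restrictScalars k, (isExpandLinear_restrictScalars d).mem_weylAlgebra⟩
  map_one' := rfl
  map_mul' _ _ := rfl
  map_zero' := rfl
  map_add' _ _ := rfl

theorem endToWeylAlgebra_apply (r : ℕ)
    (d : Module.End (expand (p ^ r) : MvPolynomial (Fin n) k →ₐ[k] _).range
      (MvPolynomial (Fin n) k)) (f : MvPolynomial (Fin n) k) :
    (endToWeylAlgebra k n p r d).1 f = d f :=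
  rfl

end CharP

theorem hasNoetherianDualBases_mulOpposite_weylAlgebra (k : Type*) [Field k] (n p : ℕ) [Fact p.Prime]
    [CharP k p] :
    HasNoetherianDualBases (weylAlgebra k n)ᵐᵒᵖ := by
  intro m a
  obtain ⟨r, -, hr⟩ := exists_forall_isExpandLinear (p := p) (fun l => (a l).unop) 0
  have hq : ∀ r, 0 < p ^ r := fun r => pow_pos (Fact.out : p.Prime).pos r
  refine ⟨_, _, isNoetherianRing_mulOpposite_end_range_expand (k := k) (n := n) (hq r),
    (endToWeylAlgebra k n p r).op, fun l => ⟨.op (hr l).toEnd, rfl⟩, fun c => ?_⟩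
  obtain ⟨s, hrs, hs⟩ := exists_forall_isExpandLinear (p := p) (fun l => (c l).unop) r
  refine ⟨Fin n → Fin (p ^ s), inferInstance, fun i => .op
    ⟨LinearMap.mulLeft k (monomial (Finsupp.equivFunOnFinite.symm fun _ => p ^ r - 1) 1) *
      (topCoeff k n (p ^ s) * LinearMap.mulLeft k (boxMonomial k (Fin.rev ∘ i))),
      mul_mem (mulLeft_mem_weylAlgebra _) (mul_mem (topCoeff_mem_weylAlgebra s)
        (mulLeft_mem_weylAlgebra _))⟩,
    fun i => { toFun := fun x => .op (LinearMap.mulLeft _ (x.unop.1 (boxMonomial k i)) *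
                  (isExpandLinear_topCoeff (p ^ r)).toEnd)
               map_zero' := ?_
               map_add' := ?_ }, fun i x d => ?_, fun l => ?_⟩
  · refine MulOpposite.unop_injective (LinearMap.ext fun f => ?_)
    simp
  · intro x y
    refine MulOpposite.unop_injective (LinearMap.ext fun f => ?_)
    simp [add_mul]
  · refine MulOpposite.unop_injective (LinearMap.ext fun f => ?_)
    obtain ⟨g, hg⟩ := exists_expand_eq_topCoeff (p ^ r) f
    have h := isExpandLinear_restrictScalars d.unop g (x.unop.1 (boxMonomial k i))
    rw [hg, mul_comm, mul_comm (topCoeff k n _ f)] at h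
    exact h.symm
  · refine MulOpposite.unop_injective (Subtype.ext (LinearMap.ext fun f => ?_))
    have key := (hs l).apply_eq_sum (hq s) f
    rw [key, Finset.unop_sum, AddSubmonoidClass.coe_finsetSum, LinearMap.sum_apply]
    refine Finset.sum_congr rfl fun i _ => ?_
    simp [endToWeylAlgebra_apply, IsExpandLinear.toEnd_apply,
      topCoeff_monomial_mul_topCoeff_of_dvd (hq r) (pow_dvd_pow p hrs)]

theorem exists_isTopAdjoint_weylAlgebra {k : Type*} [Field k] {n : ℕ} (p : ℕ) [Fact p.Prime]
    [CharP k p] (c : weylAlgebra k n) :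
    ∃ d : weylAlgebra k n, ∃ r, ∀ s, r ≤ s → IsTopAdjoint (p ^ s) c.1 d.1 := by
  obtain ⟨r, hr⟩ := exists_isExpandLinear_of_mem_weylAlgebra (p := p) c.2
  have hq : ∀ r, 0 < p ^ r := fun r => pow_pos (Fact.out : p.Prime).pos r
  obtain ⟨d, hd, hcd⟩ := (hr r le_rfl).exists_isTopAdjoint (hq r)
  exact ⟨⟨d, hd.mem_weylAlgebra⟩, r, fun s hs => hcd.of_dvd (hq s) (pow_dvd_pow p hs)⟩

theorem exists_ringEquiv_mulOpposite_weylAlgebra (k : Type*) [Field k] (n p : ℕ) [Fact p.Prime]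
    [CharP k p] :
    Nonempty ((weylAlgebra k n)ᵐᵒᵖ ≃+* weylAlgebra k n) := by
  choose σ r hσ using exists_isTopAdjoint_weylAlgebra (k := k) (n := n) p
  have hq : ∀ r, 0 < p ^ r := fun r => pow_pos (Fact.out : p.Prime).pos r
  have uniq : ∀ (c d : weylAlgebra k n) (s : ℕ),
      (∀ t, s ≤ t → IsTopAdjoint (p ^ t) c.1 d.1) → σ c = d := fun c d s h =>
    Subtype.ext ((hσ c _ (le_max_left (r c) s)).eq (hq _) (h _ (le_max_right (r c) s)))
  exact ⟨{
    toFun := fun c => σ c.unop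
    invFun := fun c => .op (σ c)
    left_inv := fun c => congrArg MulOpposite.op
      (uniq _ _ (r c.unop) fun t ht => (hσ _ t ht).symm)
    right_inv := fun c => uniq _ _ (r c) fun t ht => (hσ _ t ht).symm
    map_mul' := fun x y => uniq _ _ (max (r x.unop) (r y.unop)) fun t ht =>
      (hσ _ t (le_of_max_le_right ht)).mul (hσ _ t (le_of_max_le_left ht))
    map_add' := fun x y => uniq _ _ (max (r x.unop) (r y.unop)) fun t ht =>
      (hσ _ t (le_of_max_le_left ht)).add (hσ _ t (le_of_max_le_right ht)) }⟩

/-- The Weyl algebra `A_n(k)` over a field of characteristic `p > 0` is a coherent ring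
(both left and right coherent). -/
theorem weylAlgebra_coherent_charP (k : Type*) [Field k] (p : ℕ) (hp : 0 < p) [CharP k p]
    (n : ℕ) (hn : 1 ≤ n) :
    IsLeftCoherent (weylAlgebra k n) ∧ IsRightCoherent (weylAlgebra k n) := by
  have : Fact p.Prime := ⟨(CharP.char_is_prime_or_zero k p).resolve_right hp.ne'⟩
  have hR := hasNoetherianDualBases_mulOpposite_weylAlgebra k n p
  obtain ⟨σ⟩ := exists_ringEquiv_mulOpposite_weylAlgebra k n p
  exact ⟨(hR.of_ringEquiv σ).finitePresentation, hR.finitePresentation⟩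
end

section
/- Let k be a field of characteristic p > 0, n ≥ 1, and A = k[x_1,…,x_n]. For every integer r ≥ 0, the ring D_r = End_{A_r}(A) of A_r-module endomorphisms of A, where A_r = k[x_1^{p^r},…,x_n^{p^r}], is left and right Noetherian; in particular D_r is a coherent ring. -/
open MvPolynomial in
/-- `k[x_1,…,x_n]` is module-finite over every subalgebra containing `x_1^q,…,x_n^q`, `q ≥ 1`. -/
theorem MvPolynomial.finite_of_X_pow_mem {k σ : Type*} [CommRing k] [Finite σ] {q : ℕ}
    (hq : 0 < q) (B : Subalgebra k (MvPolynomial σ k)) (hB : ∀ i, X i ^ q ∈ B) :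
    Module.Finite B (MvPolynomial σ k) := by
  have htop : Algebra.adjoin B (Set.range (X : σ → MvPolynomial σ k)) = ⊤ := by
    refine top_unique fun f _ => ?_
    induction f using MvPolynomial.induction_on with
    | C a => exact Subalgebra.algebraMap_mem _ (algebraMap k B a)
    | add f g hf hg => exact add_mem (hf trivial) (hg trivial)
    | mul_X f i hf => exact mul_mem (hf trivial) (Algebra.subset_adjoin ⟨i, rfl⟩)
  have hint : ∀ x ∈ Set.range (X : σ → MvPolynomial σ k), IsIntegral B x := by
    rintro _ ⟨i, rfl⟩
    exact .of_pow hq (isIntegral_algebraMap (R := B) (x := ⟨_, hB i⟩))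
  refine ⟨?_⟩
  rw [← Algebra.top_toSubmodule, ← htop]
  exact fg_adjoin_of_finite (Set.finite_range _) hint

/-- The polynomial ring is a finite module over `A_r`. -/
theorem finite_subAr (k : Type*) [Field k] (n : ℕ) {p : ℕ} (hp : 0 < p) (r : ℕ) :
    Module.Finite (subAr k n p r) (MvPolynomial (Fin n) k) :=
  MvPolynomial.finite_of_X_pow_mem (pow_pos hp r) _ fun i => Algebra.subset_adjoin ⟨i, rfl⟩

/-- The ring `A_r` is Noetherian. -/
theorem isNoetherianRing_subAr (k : Type*) [Field k] (n p r : ℕ) :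
    IsNoetherianRing (subAr k n p r) :=
  isNoetherianRing_of_fg (Subalgebra.fg_def.2 ⟨_, Set.finite_range _, rfl⟩)

/-- The endomorphism ring of a finite module over a commutative Noetherian ring is left
Noetherian. -/
theorem Module.End.isNoetherianRing (R M : Type*) [CommRing R] [IsNoetherianRing R]
    [AddCommGroup M] [Module R M] [Module.Finite R M] : IsNoetherianRing (Module.End R M) :=
  IsNoetherianRing.of_finite R _

/-- The endomorphism ring of a finite module over a commutative Noetherian ring is right
Noetherian. -/
theorem Module.End.isNoetherianRing_op (R M : Type*) [CommRing R] [IsNoetherianRing R]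
    [AddCommGroup M] [Module R M] [Module.Finite R M] : IsNoetherianRing (Module.End R M)ᵐᵒᵖ :=
  have : Module.Finite R (Module.End R M)ᵐᵒᵖ :=
    Module.Finite.equiv (MulOpposite.opLinearEquiv R : Module.End R M ≃ₗ[R] _)
  IsNoetherianRing.of_finite R _

/-- The centralizer of the multiplications by elements of `A_r` is `End_{A_r}(A)`. -/
noncomputable def endArEquiv (k : Type*) [Field k] (n p r : ℕ) :
    Module.End (subAr k n p r) (MvPolynomial (Fin n) k) ≃+* endAr k n p r where
  toFun f := ⟨f.restrictScalars k, by
    rintro _ ⟨b, hb, rfl⟩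
    refine LinearMap.ext fun x => ?_
    exact (f.map_smul ⟨b, hb⟩ x).symm⟩
  invFun f :=
    { toFun := f.1
      map_add' := f.1.map_add
      map_smul' := fun b x => (LinearMap.congr_fun (f.2 _ ⟨b.1, b.2, rfl⟩) x).symm }
  left_inv _ := rfl
  right_inv _ := rfl
  map_mul' _ _ := rfl
  map_add' _ _ := rfl

theorem IsLeftCoherent.of_isNoetherianRing (R : Type*) [Ring R] [IsNoetherianRing R] :
    IsLeftCoherent R := fun I hI =>
  have : Module.Finite R I := Module.Finite.iff_fg.mpr hI
  Module.finitePresentation_of_finite R I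

theorem IsRightCoherent.of_isNoetherianRing (R : Type*) [Ring R] [IsNoetherianRing Rᵐᵒᵖ] :
    IsRightCoherent R :=
  IsLeftCoherent.of_isNoetherianRing Rᵐᵒᵖ

/-- `D_r = End_{A_r}(A)` is left and right Noetherian; in particular it is a coherent ring. -/
theorem endAr_noetherian_coherent (k : Type*) [Field k] (p : ℕ) (hp : 0 < p) [CharP k p]
    (n : ℕ) (hn : 1 ≤ n) (r : ℕ) :
    IsNoetherianRing (endAr k n p r) ∧ IsNoetherianRing (endAr k n p r)ᵐᵒᵖ ∧
      IsLeftCoherent (endAr k n p r) ∧ IsRightCoherent (endAr k n p r) := by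
  have := finite_subAr k n hp r
  have := isNoetherianRing_subAr k n p r
  have := Module.End.isNoetherianRing (subAr k n p r) (MvPolynomial (Fin n) k)
  have := Module.End.isNoetherianRing_op (subAr k n p r) (MvPolynomial (Fin n) k)
  have := isNoetherianRing_of_ringEquiv _ (endArEquiv k n p r)
  have := isNoetherianRing_of_ringEquiv _ (endArEquiv k n p r).op
  exact ⟨‹_›, ‹_›, .of_isNoetherianRing _, .of_isNoetherianRing _⟩
end

section
/- Let D be a ring and (D_r)_{r ∈ ℕ} an ascending chain of subrings D_0 ⊆ D_1 ⊆ D_2 ⊆ … with D = ⋃_{r ≥ 0} D_r. Suppose that each D_r is a left coherent ring and that for all s ≤ r the ring D_r is flat as a right D_s-module. Then D is a left coherent ring. (Symmetrically, if each D_r is right coherent and each D_r is flat as a left D_s-module for s ≤ r, then D is right coherent.) -/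
/-- Flatness of a (left) module over a possibly noncommutative ring, via the standard
equational criterion (Lazard/Villamayor): every finite relation `∑ rᵢ • xᵢ = 0` is trivial.
Over a commutative ring this is equivalent to `Module.Flat`; applying it to `Rᵐᵒᵖ`-modules
gives flatness of right modules. -/
def IsFlatModule (R : Type*) [Ring R] (M : Type*) [AddCommGroup M] [Module R M] : Prop :=
  ∀ (m : ℕ) (x : Fin m → M) (r : Fin m → R), (∑ i, r i • x i) = 0 →
    ∃ (l : ℕ) (y : Fin l → M) (a : Fin m → Fin l → R),
      (∀ i, x i = ∑ j, a i j • y j) ∧ ∀ j, (∑ i, r i * a i j) = 0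

/-- The linear combinations of a finite family form a finitely presented module exactly when the
relations of the family are finitely generated. -/
theorem fg_ker_linearCombination_iff {R M ι : Type*} [Ring R] [AddCommGroup M] [Module R M]
    [Fintype ι] (v : ι → M) :
    (LinearMap.ker (Fintype.linearCombination R v)).FG ↔
      Module.FinitePresentation R (Submodule.span R (Set.range v)) := by
  rw [← Fintype.range_linearCombination, ← Module.FinitePresentation.fg_ker_iff
    (Fintype.linearCombination R v).rangeRestrict (LinearMap.surjective_rangeRestrict _),
    LinearMap.ker_rangeRestrict]

/-- A ring is left coherent iff the left relations of every finite family are finitely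
generated. -/
theorem isLeftCoherent_iff_fg_ker {R : Type*} [Ring R] :
    IsLeftCoherent R ↔ ∀ (n : ℕ) (v : Fin n → R),
      (LinearMap.ker (Fintype.linearCombination R v)).FG := by
  refine ⟨fun h n v ↦ ?_, fun h I hI ↦ ?_⟩
  · exact (fg_ker_linearCombination_iff v).2
      (h _ (Submodule.fg_span (Set.finite_range v)))
  · obtain ⟨n, v, rfl⟩ := Submodule.fg_iff_exists_fin_generating_family.1 hI
    exact (fg_ker_linearCombination_iff v).1 (h n v)

/-- A ring is left coherent if every finite family descends along a ring homomorphism from a left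
coherent ring in such a way that all relations come from relations of the descended family. -/
theorem isLeftCoherent_of_exists_descent {D : Type*} [Ring D]
    (H : ∀ (n : ℕ) (d : Fin n → D), ∃ (R : Type*) (_ : Ring R) (f : R →+* D) (c : Fin n → R),
      IsLeftCoherent R ∧ (∀ i, f (c i) = d i) ∧
      ∀ x : Fin n → D, ∑ i, x i * d i = 0 → ∃ (l : ℕ) (y : Fin l → D) (a : Fin l → Fin n → R),
        (∀ i, x i = ∑ j, y j * f (a j i)) ∧ ∀ j, ∑ i, a j i * c i = 0) :
    IsLeftCoherent D := by
  refine isLeftCoherent_iff_fg_ker.2 fun n d ↦ ?_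
  obtain ⟨R, _, f, c, hR, hc, hrel⟩ := H n d
  obtain ⟨p, k, hk⟩ := Submodule.fg_iff_exists_fin_generating_family.1
    (isLeftCoherent_iff_fg_ker.1 hR n c)
  refine Submodule.fg_iff_exists_fin_generating_family.2 ⟨p, fun q i ↦ f (k q i), le_antisymm ?_ ?_⟩
  · rw [Submodule.span_le]
    rintro _ ⟨q, rfl⟩
    have hq : k q ∈ LinearMap.ker (Fintype.linearCombination R c) :=
      hk ▸ Submodule.subset_span ⟨q, rfl⟩
    simpa [Fintype.linearCombination_apply, hc] using congrArg f hq
  · intro x hx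
    obtain ⟨l, y, a, hxy, ha⟩ := hrel x (by simpa [Fintype.linearCombination_apply] using hx)
    have hx' : x = ∑ j, y j • fun i ↦ f (a j i) := by
      ext i
      simp [hxy]
    rw [hx']
    refine Submodule.sum_mem _ fun j _ ↦ Submodule.smul_mem _ _ ?_
    have haj : a j ∈ Submodule.span R (Set.range k) := by
      rw [hk]
      simpa [Fintype.linearCombination_apply] using ha j
    obtain ⟨b, hb⟩ := (Submodule.mem_span_range_iff_exists_fun R).1 haj
    refine (Submodule.mem_span_range_iff_exists_fun D).2 ⟨fun q ↦ f (b q), ?_⟩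
    ext i
    simp [← hb]

/-- A finite family in the union of an ascending chain of subrings lies in all late members. -/
theorem exists_forall_ge_forall_mem {D : Type*} [Ring D] {Dr : ℕ → Subring D} (hmono : Monotone Dr)
    (hunion : ∀ x : D, ∃ r, x ∈ Dr r) {ι : Type*} [Finite ι] (x : ι → D) :
    ∃ s, ∀ r, s ≤ r → ∀ i, x i ∈ Dr r := by
  choose ρ hρ using hunion
  obtain ⟨s, hs⟩ := Set.Finite.bddAbove (Set.finite_range fun i ↦ ρ (x i))
  exact ⟨s, fun r hr i ↦ hmono ((hs ⟨i, rfl⟩).trans hr) (hρ _)⟩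

/-- Let `D` be a ring exhausted by an ascending chain of subrings `D_0 ⊆ D_1 ⊆ ⋯`.
If each `D_r` is left coherent and each `D_r` is flat as a right `D_s`-module for `s ≤ r`,
then `D` is left coherent; symmetrically, if each `D_r` is right coherent and each `D_r` is
flat as a left `D_s`-module for `s ≤ r`, then `D` is right coherent. (Flatness of a right
module is expressed via the left module structure on the `ᵐᵒᵖ` side.) -/
theorem isLeftCoherent_of_directed_union (D : Type*) [Ring D] (Dr : ℕ → Subring D)
    (hmono : ∀ s r : ℕ, s ≤ r → Dr s ≤ Dr r)
    (hunion : ∀ x : D, ∃ r, x ∈ Dr r) :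
    ((∀ r, IsLeftCoherent (Dr r)) →
      (∀ s r (h : s ≤ r),
        letI := (RingHom.op (Subring.inclusion (hmono s r h))).toModule
        IsFlatModule (Dr s)ᵐᵒᵖ (Dr r)ᵐᵒᵖ) →
      IsLeftCoherent D) ∧
    ((∀ r, IsRightCoherent (Dr r)) →
      (∀ s r (h : s ≤ r),
        letI := (Subring.inclusion (hmono s r h)).toModule
        IsFlatModule (Dr s) (Dr r)) →
      IsRightCoherent D) := by
  have hmono' : Monotone Dr := fun s r h ↦ hmono s r h
  constructor
  · intro hcoh hflat
    refine isLeftCoherent_of_exists_descent fun n d ↦ ?_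
    obtain ⟨s, hs⟩ := exists_forall_ge_forall_mem hmono' hunion d
    refine ⟨Dr s, inferInstance, (Dr s).subtype, fun i ↦ ⟨d i, hs s le_rfl i⟩, hcoh s,
      fun i ↦ rfl, fun x hx ↦ ?_⟩
    obtain ⟨t, ht⟩ := exists_forall_ge_forall_mem hmono' hunion x
    obtain ⟨l, y, a, hxy, ha⟩ := hflat s (max s t) (le_max_left s t) n
      (fun i ↦ .op ⟨x i, ht _ (le_max_right s t) i⟩) (fun i ↦ .op ⟨d i, hs s le_rfl i⟩) (by
        apply MulOpposite.unop_injective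
        apply Subtype.ext
        simp only [Finset.unop_sum, AddSubmonoidClass.coe_finsetSum]
        exact hx)
    refine ⟨l, fun j ↦ (y j).unop, fun j i ↦ (a i j).unop, fun i ↦ ?_, fun j ↦ ?_⟩
    · have h := congrArg (fun z ↦ (z.unop : D)) (hxy i)
      simp only [Finset.unop_sum, AddSubmonoidClass.coe_finsetSum] at h
      exact h
    · simpa using congrArg MulOpposite.unop (ha j)
  · intro hcoh hflat
    refine isLeftCoherent_of_exists_descent fun n d ↦ ?_
    obtain ⟨s, hs⟩ := exists_forall_ge_forall_mem hmono' hunion fun i ↦ (d i).unop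
    refine ⟨(Dr s)ᵐᵒᵖ, inferInstance, (Dr s).subtype.op, fun i ↦ .op ⟨_, hs s le_rfl i⟩, hcoh s,
      fun i ↦ rfl, fun x hx ↦ ?_⟩
    obtain ⟨t, ht⟩ := exists_forall_ge_forall_mem hmono' hunion fun i ↦ (x i).unop
    obtain ⟨l, y, a, hxy, ha⟩ := hflat s (max s t) (le_max_left s t) n
      (fun i ↦ ⟨_, ht _ (le_max_right s t) i⟩) (fun i ↦ ⟨_, hs s le_rfl i⟩) (by
        apply Subtype.ext
        have h := congrArg MulOpposite.unop hx
        simp only [Finset.unop_sum] at h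
        simp only [AddSubmonoidClass.coe_finsetSum]
        exact h)
    refine ⟨l, fun j ↦ .op (y j), fun j i ↦ .op (a i j), fun i ↦ ?_, fun j ↦ ?_⟩
    · apply MulOpposite.unop_injective
      have h := congrArg Subtype.val (hxy i)
      simp only [AddSubmonoidClass.coe_finsetSum] at h
      simp only [Finset.unop_sum]
      exact h
    · apply MulOpposite.unop_injective
      simpa using ha j
end
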